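/- Let n > 1 and μ ∈ ℝ. Work on ℝ^{2n+1} with coordinates (x^1,…,x^n,u,u_1,…,u_n). Let (g^{ij}) be a constant, symmetric, invertible real n×n matrix and T := (1/2) Σ_{i,j} g^{ij} u_i u_j, V(u) := (1/2) μ u². Let U, U_1,…,U_n, f^1,…,f^n be infinitely differentiable (C^∞) functions on ℝ^{2n+1}. Then the PD-Noether equations — (16) Σ_i ∂_{x^i}f^i + Σ_{i,j} g^{ij} u_i U_j + μ u U = 0; (17) ∂_u f^i − Σ_j g^{ij} U_j = 0 for all i; (18) ∂_{u_j} f^i + g^{ij} U = 0 for all i,j — hold if and only if: U depends only on (x^1,…,x^n) (i.e. ∂_u U = 0 and ∂_{u_j} U = 0 for all j), Σ_{i,j} g^{ij} ∂²_{x^i x^j} U + μ U = 0, U_j = ∂_{x^j} U for all j, and the functions B^i := f^i − Σ_j g^{ij}( u ∂_{x^j}U − u_j U ) satisfy ∂_u B^i = 0, ∂_{u_k} B^i = 0 for all i,k, and Σ_i ∂_{x^i} B^i = 0. -/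

import Mathlib

open scoped BigOperators

/-- The space `ℝ^{2n+1}` with coordinates `(x^1,…,x^n, u, u_1,…,u_n)`. -/
abbrev Space (n : ℕ) := (Fin n → ℝ) × ℝ × (Fin n → ℝ)

/-- Partial derivative with respect to `x^i`. -/
noncomputable def pdxi {n : ℕ} (i : Fin n) (f : Space n → ℝ) (p : Space n) : ℝ :=
  fderiv ℝ f p (Pi.single i 1, (0 : ℝ), (0 : Fin n → ℝ))

/-- Partial derivative with respect to `u`. -/
noncomputable def pdu {n : ℕ} (f : Space n → ℝ) (p : Space n) : ℝ :=
  fderiv ℝ f p ((0 : Fin n → ℝ), (1 : ℝ), (0 : Fin n → ℝ))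

/-- Partial derivative with respect to `u_j`. -/
noncomputable def pduj {n : ℕ} (j : Fin n) (f : Space n → ℝ) (p : Space n) : ℝ :=
  fderiv ℝ f p ((0 : Fin n → ℝ), (0 : ℝ), Pi.single j 1)

/-- Directional derivatives of a smooth function commute. -/
theorem fderiv_fderiv_apply_comm {E : Type*} [NormedAddCommGroup E] [NormedSpace ℝ E]
    {F : E → ℝ} (hF : ContDiff ℝ (⊤ : ℕ∞) F) (v w p : E) :
    fderiv ℝ (fun q => fderiv ℝ F q w) p v = fderiv ℝ (fun q => fderiv ℝ F q v) p w := by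
  have hd : DifferentiableAt ℝ (fderiv ℝ F) p :=
    ((hF.fderiv_right (m := (⊤ : ℕ∞)) (by simp)).differentiable (by simp)) p
  have hs : IsSymmSndFDerivAt ℝ F p := hF.contDiffAt.isSymmSndFDerivAt (by
    simpa using WithTop.coe_le_coe.2 (le_top : (2 : ℕ∞) ≤ ⊤))
  rw [fderiv_clm_apply hd (differentiableAt_const w),
    fderiv_clm_apply hd (differentiableAt_const v)]
  simpa using hs.eq v w

theorem ContDiff.fderiv_apply_const {E : Type*} [NormedAddCommGroup E] [NormedSpace ℝ E]
    {F : E → ℝ} (hF : ContDiff ℝ (⊤ : ℕ∞) F) (v : E) :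
    ContDiff ℝ (⊤ : ℕ∞) (fun q => fderiv ℝ F q v) :=
  (hF.fderiv_right (m := (⊤ : ℕ∞)) (by simp)).clm_apply contDiff_const

theorem ContDiff.differentiable_of_smooth {E : Type*} [NormedAddCommGroup E] [NormedSpace ℝ E]
    {F : E → ℝ} (hF : ContDiff ℝ (⊤ : ℕ∞) F) : Differentiable ℝ F :=
  hF.differentiable (by simp)

theorem hasFDerivAt_coord_u {n : ℕ} (p : Space n) :
    HasFDerivAt (fun q : Space n => q.2.1)
      ((ContinuousLinearMap.fst ℝ ℝ (Fin n → ℝ)).comp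
        (ContinuousLinearMap.snd ℝ (Fin n → ℝ) (ℝ × (Fin n → ℝ)))) p :=
  ((ContinuousLinearMap.fst ℝ ℝ (Fin n → ℝ)).comp
    (ContinuousLinearMap.snd ℝ (Fin n → ℝ) (ℝ × (Fin n → ℝ)))).hasFDerivAt

theorem hasFDerivAt_coord_uj {n : ℕ} (j : Fin n) (p : Space n) :
    HasFDerivAt (fun q : Space n => q.2.2 j)
      ((ContinuousLinearMap.proj (R := ℝ) (φ := fun _ : Fin n => ℝ) j).comp
        ((ContinuousLinearMap.snd ℝ ℝ (Fin n → ℝ)).comp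
          (ContinuousLinearMap.snd ℝ (Fin n → ℝ) (ℝ × (Fin n → ℝ))))) p :=
  ((ContinuousLinearMap.proj (R := ℝ) (φ := fun _ : Fin n => ℝ) j).comp
    ((ContinuousLinearMap.snd ℝ ℝ (Fin n → ℝ)).comp
      (ContinuousLinearMap.snd ℝ (Fin n → ℝ) (ℝ × (Fin n → ℝ))))).hasFDerivAt

/-- The derivative of `B^i = f^i − g^{ij}(u A_j − u_j U)` in the direction `v`. -/
theorem fderiv_sub_current {n : ℕ} {a : Fin n → ℝ} {U F : Space n → ℝ}
    {A : Fin n → Space n → ℝ} (hF : Differentiable ℝ F) (hU : Differentiable ℝ U)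
    (hA : ∀ j, Differentiable ℝ (A j)) (p v : Space n) :
    fderiv ℝ (fun q => F q - ∑ j, a j * (q.2.1 * A j q - q.2.2 j * U q)) p v =
      fderiv ℝ F p v - ∑ j, a j * (p.2.1 * fderiv ℝ (A j) p v + v.2.1 * A j p
        - (p.2.2 j * fderiv ℝ U p v + v.2.2 j * U p)) := by
  have h := (hF p).hasFDerivAt.sub (HasFDerivAt.fun_sum (u := Finset.univ) fun j _ =>
    (((hasFDerivAt_coord_u p).mul (hA j p).hasFDerivAt).sub
      ((hasFDerivAt_coord_uj j p).mul (hU p).hasFDerivAt)).const_mul (a j))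
  refine (congrArg (fun L => L v) (HasFDerivAt.fderiv h)).trans ?_
  simp [sum_apply, mul_comm]

/-- The derivative in the direction `v` of the left-hand side of the divergence equation. -/
theorem fderiv_divergence {n : ℕ} {g : Fin n → Fin n → ℝ} {μ : ℝ} {U : Space n → ℝ}
    {G A : Fin n → Space n → ℝ} (hG : ∀ i, Differentiable ℝ (G i))
    (hU : Differentiable ℝ U) (hA : ∀ j, Differentiable ℝ (A j)) (p v : Space n) :
    fderiv ℝ (fun q : Space n => (∑ i, G i q) + (∑ i, ∑ j, g i j * q.2.2 i * A j q) +
        μ * q.2.1 * U q) p v =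
      (∑ i, fderiv ℝ (G i) p v) +
        (∑ i, ∑ j, g i j * (v.2.2 i * A j p + p.2.2 i * fderiv ℝ (A j) p v)) +
        μ * (v.2.1 * U p + p.2.1 * fderiv ℝ U p v) := by
  have h := ((HasFDerivAt.fun_sum (u := Finset.univ) fun i _ => (hG i p).hasFDerivAt).add
    (HasFDerivAt.fun_sum (u := Finset.univ) fun i _ =>
      HasFDerivAt.fun_sum (u := Finset.univ) fun j _ =>
        ((hasFDerivAt_coord_uj i p).const_mul (g i j)).mul (hA j p).hasFDerivAt)).add
    (((hasFDerivAt_coord_u p).const_mul μ).mul (hU p).hasFDerivAt)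
  refine (congrArg (fun L => L v) (HasFDerivAt.fderiv h)).trans ?_
  simp only [add_apply, sum_apply, smul_apply, ContinuousLinearMap.comp_apply,
    ContinuousLinearMap.coe_fst', ContinuousLinearMap.coe_snd', ContinuousLinearMap.proj_apply,
    smul_eq_mul]
  congr 1
  · congr 1
    refine Finset.sum_congr rfl fun i _ => Finset.sum_congr rfl fun j _ => ?_
    ring
  · ring

theorem eq_of_sum_mul_eq {n : ℕ} {g : Fin n → Fin n → ℝ} (hg : (Matrix.of g).det ≠ 0)
    {a b : Fin n → ℝ} (h : ∀ i, ∑ j, g i j * a j = ∑ j, g i j * b j) : a = b :=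
  Matrix.mulVec_injective_of_isUnit
    ((Matrix.isUnit_iff_isUnit_det _).2 (isUnit_iff_ne_zero.2 hg))
    (funext h)

/-- for `T = (1/2) g^{ij} u_i u_j` and `V = (1/2) μ u²`, the
PD-Noether equations (16)–(18) hold iff `U` is an `x`-only solution of
`g^{ij}∂²_{ij}U + μU = 0`, `U_j = ∂_{x^j}U`, and
`B^i = f^i − g^{ij}(u ∂_{x^j}U − u_j U)` are `x`-only functions with vanishing
divergence. -/
theorem stmt_10 (n : ℕ) (hn : 1 < n) (μ : ℝ)
    (g : Fin n → Fin n → ℝ) (hgsymm : ∀ i j, g i j = g j i)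
    (hginv : (Matrix.of g).det ≠ 0)
    (U : Space n → ℝ) (Uj : Fin n → Space n → ℝ) (f : Fin n → Space n → ℝ)
    (hU : ContDiff ℝ (⊤ : ℕ∞) U) (hUj : ∀ j, ContDiff ℝ (⊤ : ℕ∞) (Uj j))
    (hf : ∀ i, ContDiff ℝ (⊤ : ℕ∞) (f i)) :
    ((∀ p : Space n,
        (∑ i, pdxi i (f i) p) + (∑ i, ∑ j, g i j * p.2.2 i * Uj j p) +
          μ * p.2.1 * U p = 0) ∧
     (∀ (i : Fin n) (p : Space n), pdu (f i) p - (∑ j, g i j * Uj j p) = 0) ∧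
     (∀ (i j : Fin n) (p : Space n), pduj j (f i) p + g i j * U p = 0)) ↔
    ((∀ p : Space n, pdu U p = 0) ∧
     (∀ (j : Fin n) (p : Space n), pduj j U p = 0) ∧
     (∀ p : Space n, (∑ i, ∑ j, g i j * pdxi i (pdxi j U) p) + μ * U p = 0) ∧
     (∀ (j : Fin n) (p : Space n), Uj j p = pdxi j U p) ∧
     (∀ (i : Fin n) (p : Space n),
        pdu (fun p' => f i p' -
          ∑ j, g i j * (p'.2.1 * pdxi j U p' - p'.2.2 j * U p')) p = 0) ∧
     (∀ (i k : Fin n) (p : Space n),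
        pduj k (fun p' => f i p' -
          ∑ j, g i j * (p'.2.1 * pdxi j U p' - p'.2.2 j * U p')) p = 0) ∧
     (∀ p : Space n,
        (∑ i, pdxi i (fun p' => f i p' -
          ∑ j, g i j * (p'.2.1 * pdxi j U p' - p'.2.2 j * U p')) p) = 0)) := by
  have dU := hU.differentiable_of_smooth
  have dxU : ∀ j, Differentiable ℝ (pdxi j U) := fun j =>
    (hU.fderiv_apply_const _).differentiable_of_smooth
  have dA : ∀ j, Differentiable ℝ (Uj j) := fun j => (hUj j).differentiable_of_smooth
  have df : ∀ j, Differentiable ℝ (f j) := fun j => (hf j).differentiable_of_smooth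
  have hB : ∀ i (p v : Space n), fderiv ℝ (fun p' => f i p' -
      ∑ j, g i j * (p'.2.1 * pdxi j U p' - p'.2.2 j * U p')) p v =
      fderiv ℝ (f i) p v - ∑ j, g i j * (p.2.1 * fderiv ℝ (pdxi j U) p v + v.2.1 * pdxi j U p
        - (p.2.2 j * fderiv ℝ U p v + v.2.2 j * U p)) :=
    fun i => fderiv_sub_current (df i) dU dxU
  have hBu : ∀ i p, (∀ q, pdu U q = 0) → pdu (fun p' => f i p' -
      ∑ j, g i j * (p'.2.1 * pdxi j U p' - p'.2.2 j * U p')) p =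
      pdu (f i) p - ∑ j, g i j * pdxi j U p := by
    intro i p h
    have hx : ∀ j, pdu (pdxi j U) p = 0 := fun j => by
      refine (fderiv_fderiv_apply_comm hU _ _ p).trans ?_
      change fderiv ℝ (pdu U) p _ = 0
      simp [show pdu U = fun _ => 0 from funext h]
    have := hB i p (0, 1, 0)
    simp only [pdu] at h hx ⊢
    rw [this]
    simp [h, hx]
  have hBuj : ∀ i k p, (∀ j q, pduj j U q = 0) → pduj k (fun p' => f i p' -
      ∑ j, g i j * (p'.2.1 * pdxi j U p' - p'.2.2 j * U p')) p =
      pduj k (f i) p + g i k * U p := by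
    intro i k p h
    have hx : ∀ j, pduj k (pdxi j U) p = 0 := fun j => by
      refine (fderiv_fderiv_apply_comm hU _ _ p).trans ?_
      change fderiv ℝ (pduj k U) p _ = 0
      simp [show pduj k U = fun _ => 0 from funext (h k)]
    have := hB i p (0, 0, Pi.single k 1)
    simp only [pduj] at h hx ⊢
    rw [this]
    simp [h, hx, Pi.single_apply]
  have hBx : ∀ p, (∑ i, pdxi i (fun p' => f i p' -
      ∑ j, g i j * (p'.2.1 * pdxi j U p' - p'.2.2 j * U p')) p) =
      (∑ i, pdxi i (f i) p) + (∑ i, ∑ j, g i j * p.2.2 i * pdxi j U p)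
        - p.2.1 * ∑ i, ∑ j, g i j * pdxi i (pdxi j U) p := by
    intro p
    have : ∀ i, pdxi i (fun p' => f i p' -
        ∑ j, g i j * (p'.2.1 * pdxi j U p' - p'.2.2 j * U p')) p = pdxi i (f i) p
        + (∑ j, g i j * p.2.2 j * pdxi i U p) - p.2.1 * ∑ j, g i j * pdxi i (pdxi j U) p := by
      intro i
      refine (hB i p _).trans ?_
      simp only [zero_mul, Pi.zero_apply, add_zero, mul_sub, Finset.sum_sub_distrib,
        Finset.mul_sum, pdxi]
      rw [sub_sub_eq_add_sub]
      congr 1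
      · simp only [mul_assoc]
      · exact Finset.sum_congr rfl fun j _ => by ring
    simp only [this, Finset.sum_sub_distrib, Finset.sum_add_distrib, ← Finset.mul_sum]
    rw [Finset.sum_comm (f := fun i j => g i j * p.2.2 j * pdxi i U p)]
    simp only [fun i j => hgsymm j i]
  constructor
  · rintro ⟨h16, h17, h18⟩
    have huj : ∀ (j : Fin n) (p : Space n), pduj j U p = 0 := by
      have hc : ∀ i j k p, g i j * pduj k U p = g i k * pduj j U p := by
        intro i j k p
        have e : ∀ j, pduj j (f i) = fun q => -(g i j) * U q := fun j =>
          funext fun q => by linarith [h18 i j q]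
        have e' : ∀ j k, pduj k (pduj j (f i)) p = -(g i j) * pduj k U p := fun j k => by
          rw [e j, pduj, fderiv_const_mul (dU p)]; rfl
        have := fderiv_fderiv_apply_comm (hf i) (0, 0, Pi.single k 1) (0, 0, Pi.single j 1) p
        have := (e' j k).symm.trans (this.trans (e' k j))
        linarith
      intro k p
      have : Nontrivial (Fin n) := Fin.nontrivial_iff_two_le.2 hn
      obtain ⟨j, hj⟩ := exists_ne k
      have := eq_of_sum_mul_eq hginv (a := Pi.single j (pduj k U p))
        (b := Pi.single k (pduj j U p)) fun i => by simpa [Pi.single_apply] using hc i j k p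
      simpa [hj] using congrFun this j
    have hxuj : ∀ j k p, pduj k (pdxi j U) p = 0 := fun j k p => by
      refine (fderiv_fderiv_apply_comm hU _ _ p).trans ?_
      change fderiv ℝ (pduj k U) p _ = 0
      simp [show pduj k U = fun _ => 0 from funext (huj k)]
    have huuj : ∀ k p, pduj k (pdu U) p = 0 := fun k p => by
      refine (fderiv_fderiv_apply_comm hU _ _ p).trans ?_
      change fderiv ℝ (pduj k U) p _ = 0
      simp [show pduj k U = fun _ => 0 from funext (huj k)]
    have e17 : ∀ i, pdu (f i) = fun q => ∑ j, g i j * Uj j q := fun i =>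
      funext fun q => by linarith [h17 i q]
    have e18 : ∀ i j, pduj j (f i) = fun q => -(g i j) * U q := fun i j =>
      funext fun q => by linarith [h18 i j q]
    have eW : ∀ i (p v : Space n), fderiv ℝ (pdu (f i)) p v =
        ∑ j, g i j * fderiv ℝ (Uj j) p v := fun i p v => by
      rw [e17 i, fderiv_fun_sum fun j _ => (dA j p).const_mul _]
      simp [fderiv_const_mul (dA _ p)]
    have eV : ∀ i j (p v : Space n), fderiv ℝ (pduj j (f i)) p v =
        -(g i j) * fderiv ℝ U p v := fun i j p v => by
      rw [e18 i j, fderiv_const_mul (dU p)]; rfl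
    have hUjuj : ∀ i k p, ∑ j, g i j * pduj k (Uj j) p = -(g i k) * pdu U p :=
      fun i k p => (eW i p _).symm.trans
        ((fderiv_fderiv_apply_comm (hf i) _ _ p).trans (eV i k p _))
    have h16' : ∀ p v : Space n, (∑ i, fderiv ℝ (pdxi i (f i)) p v) +
        (∑ i, ∑ j, g i j * (v.2.2 i * Uj j p + p.2.2 i * fderiv ℝ (Uj j) p v)) +
        μ * (v.2.1 * U p + p.2.1 * fderiv ℝ U p v) = 0 := by
      intro p v
      rw [← fderiv_divergence (G := fun i => pdxi i (f i)) (fun i =>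
        ((hf i).fderiv_apply_const _).differentiable_of_smooth) dU dA p v]
      simp [funext h16]
    have hUj1 : ∀ p, (fun k => Uj k p) = fun k => pdxi k U p + p.2.2 k * pdu U p := by
      intro p
      refine eq_of_sum_mul_eq hginv fun k => ?_
      have h1 := h16' p (0, 0, Pi.single k 1)
      have h2 : ∀ i, fderiv ℝ (pdxi i (f i)) p (0, 0, Pi.single k 1) = -(g k i) * pdxi i U p :=
        fun i => (fderiv_fderiv_apply_comm (hf i) _ _ p).trans
          ((eV i k p _).trans (by rw [hgsymm i k]; rfl))
      have h3 : ∀ i, ∑ j, g i j * (p.2.2 i * fderiv ℝ (Uj j) p (0, 0, Pi.single k 1)) =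
          -(g k i * (p.2.2 i * pdu U p)) := fun i => by
        have := hUjuj i k p
        simp only [pduj] at this
        rw [Finset.sum_congr rfl fun j _ => mul_left_comm _ _ _, ← Finset.mul_sum, this,
          hgsymm k i]
        ring
      have h4 : fderiv ℝ U p (0, 0, Pi.single k 1) = 0 := huj k p
      have h5 : ∑ i, ∑ j, g i j * ((Pi.single k 1 : Fin n → ℝ) i * Uj j p) =
          ∑ j, g k j * Uj j p := by
        rw [Finset.sum_eq_single k]
        · simp
        · intro i _ hi; simp [hi]
        · simp
      simp only [mul_add, Finset.sum_add_distrib, h2, h3, h4, h5, Finset.sum_neg_distrib,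
        neg_mul] at h1 ⊢
      linarith
    have hu : ∀ p, pdu U p = 0 := by
      intro p
      have k : Fin n := ⟨0, by omega⟩
      have h1 : (fun j => pduj k (Uj j) p) = Pi.single k (-pdu U p) :=
        eq_of_sum_mul_eq hginv fun i => by
          rw [hUjuj i k p]; simp [Pi.single_apply]
      have h2 : Uj k = fun q => pdxi k U q + q.2.2 k * pdu U q :=
        funext fun q => congrFun (hUj1 q) k
      have h3 : pduj k (Uj k) p = pdu U p := by
        have du : DifferentiableAt ℝ (pdu U) p :=
          (hU.fderiv_apply_const _).differentiable_of_smooth p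
        have h := (dxU k p).hasFDerivAt.add ((hasFDerivAt_coord_uj k p).mul du.hasFDerivAt)
        have h4 := hxuj k k p
        have h5 := huuj k p
        rw [h2]
        refine (congrArg (fun L => L (0, 0, Pi.single k 1)) (HasFDerivAt.fderiv h)).trans ?_
        simp only [pduj] at h4 h5
        simp [h4, h5]
      have := congrFun h1 k
      simp only [Pi.single_eq_same, h3] at this
      linarith
    have hUx : ∀ (j : Fin n) (p : Space n), Uj j p = pdxi j U p := fun j p => by
      simpa [hu] using congrFun (hUj1 p) j
    have hUx' : ∀ j, Uj j = pdxi j U := fun j => funext (hUx j)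
    have hwave : ∀ p : Space n, (∑ i, ∑ j, g i j * pdxi i (pdxi j U) p) + μ * U p = 0 := by
      intro p
      have h1 := h16' p (0, 1, 0)
      have h2 : ∀ i, fderiv ℝ (pdxi i (f i)) p (0, 1, 0) = ∑ j, g i j * pdxi i (pdxi j U) p :=
        fun i => (fderiv_fderiv_apply_comm (hf i) _ _ p).trans
          ((eW i p _).trans (by simp only [hUx']; rfl))
      have h3 : ∀ j, fderiv ℝ (Uj j) p (0, 1, 0) = 0 := fun j => by
        rw [hUx']
        refine (fderiv_fderiv_apply_comm hU _ _ p).trans ?_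
        change fderiv ℝ (pdu U) p _ = 0
        simp [show pdu U = fun _ => 0 from funext hu]
      have h4 : fderiv ℝ U p (0, 1, 0) = 0 := hu p
      simpa [h2, h3, h4] using h1
    refine ⟨hu, huj, hwave, hUx, fun i p => ?_, fun i k p => ?_, fun p => ?_⟩
    · rw [hBu i p hu]
      simpa only [hUx] using h17 i p
    · rw [hBuj i k p huj]
      exact h18 i k p
    · rw [hBx p]
      have := h16 p
      simp only [hUx] at this
      linear_combination this - p.2.1 * hwave p
  · rintro ⟨hu, huj, hwave, hUx, h1, h2, h3⟩
    refine ⟨fun p => ?_, fun i p => ?_, fun i j p => ?_⟩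
    · have := h3 p
      rw [hBx p] at this
      simp only [hUx]
      linear_combination this + p.2.1 * hwave p
    · simpa only [hUx, hBu i p hu] using h1 i p
    · rw [← hBuj i j p huj]
      exact h2 i j p
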